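/- Let V^w > 0, let Δ = χ − σ^w with cos Δ ≠ 0, and set c = V^w sin Δ. Let V : ℝ → ℝ be an airspeed profile differentiable at t₀ with V(t₀) = V^w (the hover condition, where airspeed equals wind speed), and let σ(t) = χ + arcsin(c / V(t)) be the heading required to hold course χ. Then the heading rate at the hover endpoint satisfies |σ'(t₀)| = |V'(t₀)| · |tan Δ| / V^w. Consequently, straight-line traversal respecting a heading-rate limit σ̇_lim > 0 at a hover endpoint with airspeed acceleration a = V'(t₀) requires |a · tan(χ − σ^w)| ≤ V^w · σ̇_lim. -/

import Mathlib

/-- The heading profile `χ + arcsin (w sin θ / V t)` at an instant where `V t₀ = w`. -/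
lemma hasDerivAt_heading_of_hover {w θ t₀ v : ℝ} (χ : ℝ) {V : ℝ → ℝ} (hw : w ≠ 0)
    (hcos : Real.cos θ ≠ 0) (hV : HasDerivAt V v t₀) (hhover : V t₀ = w) :
    HasDerivAt (fun t => χ + Real.arcsin (w * Real.sin θ / V t))
      (1 / |Real.cos θ| * (-(v * Real.sin θ) / w)) t₀ := by
  have hratio : w * Real.sin θ / V t₀ = Real.sin θ := by
    rw [hhover, mul_div_cancel_left₀ _ hw]
  have hquot : HasDerivAt (fun t => w * Real.sin θ / V t) (-(v * Real.sin θ) / w) t₀ := by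
    refine ((hasDerivAt_const t₀ (w * Real.sin θ)).fun_div hV (hhover ▸ hw)).congr_deriv ?_
    rw [hhover]
    field_simp
    ring
  have hsq : 0 < Real.cos θ ^ 2 := by positivity
  have harcsin : HasDerivAt Real.arcsin (1 / |Real.cos θ|) (w * Real.sin θ / V t₀) := by
    rw [hratio, Real.abs_cos_eq_sqrt_one_sub_sin_sq]
    apply Real.hasDerivAt_arcsin <;> intro h <;> nlinarith [Real.sin_sq_add_cos_sq θ]
  exact (harcsin.comp t₀ hquot).const_add χ

/-- At a hover endpoint (`V t₀ = V^w`), the heading rate required to hold a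
constant course `χ` in steady wind, with heading profile
`σ t = χ + arcsin (V^w sin (χ - σ^w) / V t)`, satisfies
`|σ' t₀| = |V' t₀| * |tan (χ - σ^w)| / V^w`; hence any heading-rate limit
`σ̇_lim` forces `|V' t₀ * tan (χ - σ^w)| ≤ V^w * σ̇_lim`. -/
theorem hover_endpoint_heading_rate
    (Vw χ σw t₀ : ℝ) (V : ℝ → ℝ) (hVw : 0 < Vw)
    (hcos : Real.cos (χ - σw) ≠ 0)
    (hV : DifferentiableAt ℝ V t₀) (hhover : V t₀ = Vw) :
    let c : ℝ := Vw * Real.sin (χ - σw)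
    let σ : ℝ → ℝ := fun t => χ + Real.arcsin (c / V t)
    |deriv σ t₀| = |deriv V t₀| * |Real.tan (χ - σw)| / Vw ∧
      ∀ σlim : ℝ, 0 < σlim → |deriv σ t₀| ≤ σlim →
        |deriv V t₀ * Real.tan (χ - σw)| ≤ Vw * σlim := by
  intro c σ
  have hrate : |deriv σ t₀| = |deriv V t₀| * |Real.tan (χ - σw)| / Vw := by
    rw [(hasDerivAt_heading_of_hover χ hVw.ne' hcos hV.hasDerivAt hhover).deriv,
      Real.tan_eq_sin_div_cos]
    simp only [abs_mul, abs_div, abs_neg, abs_one, abs_abs, abs_of_pos hVw]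
    ring
  refine ⟨hrate, fun σlim _ hlim => ?_⟩
  rw [hrate, div_le_iff₀ hVw] at hlim
  rwa [abs_mul, mul_comm Vw]
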